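/- Let G and H be rayless graphs, let X ⊆ V(G) and Y ⊆ V(H) be finite vertex sets, and suppose the pairs (G,X) and (H,Y) are strong twins. Then there exist infinitely many pairwise non-isomorphic pairs (H',Y') (H' a graph, Y' ⊆ V(H') finite) each of which is a strong twin of (G,X). -/

import Mathlib

/-- A graph is rayless if it contains no ray, i.e. no infinite sequence of distinct
vertices `v₀, v₁, v₂, …` with `vᵢ` adjacent to `vᵢ₊₁` for all `i`. -/
def SimpleGraph.IsRayless {V : Type*} (G : SimpleGraph V) : Prop :=
  ¬ ∃ f : ℕ → V, Function.Injective f ∧ ∀ n, G.Adj (f n) (f (n + 1))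

/-- Two pairs `(G, X)` and `(H, Y)` are isomorphic if there is a graph isomorphism
`γ : G ≃g H` with `γ(X) = Y`. -/
def PairIso {V W : Type*} (G : SimpleGraph V) (X : Set V)
    (H : SimpleGraph W) (Y : Set W) : Prop :=
  ∃ γ : G ≃g H, ⇑γ '' X = Y

/-- Two pairs `(G, X)` and `(H, Y)` are strong twins if they are not isomorphic as
pairs, yet there are graph embeddings `φ : G ↪g H` with `φ(X) ⊆ Y` and
`ψ : H ↪g G` with `ψ(Y) ⊆ X`. -/
def StrongTwinPairs {V W : Type*} (G : SimpleGraph V) (X : Set V)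
    (H : SimpleGraph W) (Y : Set W) : Prop :=
  ¬ PairIso G X H Y ∧ (∃ φ : G ↪g H, ⇑φ '' X ⊆ Y) ∧ (∃ ψ : H ↪g G, ⇑ψ '' Y ⊆ X)

universe u

namespace RT

open Set

/-- connectedness of a vertex set, in terms of cuts -/
def Conn {V : Type*} (G : SimpleGraph V) (C : Set V) : Prop :=
  C.Nonempty ∧ ∀ T : Set V, (∃ x ∈ C, x ∈ T) →
    (∀ x ∈ C, x ∈ T → ∀ y ∈ C, G.Adj x y → y ∈ T) → C ⊆ T

theorem conn_of_root {V : Type*} {G : SimpleGraph V} {C : Set V} (v : V) (hv : v ∈ C)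
    (h : ∀ T : Set V, v ∈ T → (∀ x ∈ C, x ∈ T → ∀ y ∈ C, G.Adj x y → y ∈ T) → C ⊆ T) :
    Conn G C := by
  refine ⟨⟨v, hv⟩, ?_⟩
  rintro T ⟨x, hx, hxT⟩ hcl
  by_cases hvT : v ∈ T
  · exact h T hvT hcl
  · exfalso
    refine h Tᶜ hvT ?_ hx hxT
    intro a ha haT b hb hab hbT
    exact haT (hcl b hb hbT a ha hab.symm)

theorem Conn.image {V W : Type*} {G : SimpleGraph V} {H : SimpleGraph W} {C : Set V}
    (hC : Conn G C) (f : V → W) (hf : ∀ x y, G.Adj x y → H.Adj (f x) (f y)) :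
    Conn H (f '' C) := by
  refine ⟨hC.1.image f, ?_⟩
  rintro T ⟨_, ⟨x, hx, rfl⟩, hxT⟩ hcl
  have := hC.2 (f ⁻¹' T) ⟨x, hx, hxT⟩ (by
    intro a ha haT b hb hab
    exact hcl _ (mem_image_of_mem f ha) haT _ (mem_image_of_mem f hb) (hf _ _ hab))
  rintro _ ⟨y, hy, rfl⟩
  exact this hy

/-- component of `v` in `A` -/
def comp {V : Type*} (G : SimpleGraph V) (A : Set V) (v : V) : Set V :=
  {w | Relation.ReflTransGen (fun x y => G.Adj x y ∧ y ∈ A) v w}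

section comp
variable {V : Type*} {G : SimpleGraph V} {A : Set V}

theorem mem_comp_self (v : V) : v ∈ comp G A v := Relation.ReflTransGen.refl

theorem comp_sub {v : V} (hv : v ∈ A) : comp G A v ⊆ A := by
  intro w hw
  induction hw with
  | refl => exact hv
  | tail _ h _ => exact h.2

theorem comp_step {v x y : V} (hx : x ∈ comp G A v) (hy : y ∈ A) (h : G.Adj x y) :
    y ∈ comp G A v := Relation.ReflTransGen.tail hx ⟨h, hy⟩

theorem comp_conn (v : V) : Conn G (comp G A v) := by
  refine conn_of_root v (mem_comp_self v) ?_
  intro T hv hcl w hw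
  have : w ∈ T ∧ w ∈ comp G A v := by
    induction hw with
    | refl => exact ⟨hv, mem_comp_self v⟩
    | tail _ h ih =>
      have := comp_step ih.2 h.2 h.1
      exact ⟨hcl _ ih.2 ih.1 _ this h.1, this⟩
  exact this.1

theorem comp_trans {v x : V} (hx : x ∈ comp G A v) : comp G A x ⊆ comp G A v :=
  fun _ hw => Relation.ReflTransGen.trans hx hw

theorem Conn.sub_comp {C : Set V} (hC : Conn G C) (hCA : C ⊆ A) {v : V} (hv : v ∈ C) :
    C ⊆ comp G A v :=
  hC.2 _ ⟨v, hv, mem_comp_self v⟩ (fun _ _ hx _ hy h => comp_step hx (hCA hy) h)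

theorem comp_symm {v x : V} (hv : v ∈ A) (hx : x ∈ comp G A v) : v ∈ comp G A x :=
  (comp_conn v).sub_comp (comp_sub hv) hx (mem_comp_self v)

end comp

/-- rank at most `α` -/
def Rk {V : Type u} (G : SimpleGraph V) (α : Ordinal.{u}) (A : Set V) : Prop :=
  ∃ S : Set V, S.Finite ∧ ∀ C : Set V, C ⊆ A \ S → Conn G C →
    ∃ β : Ordinal.{u}, ∃ _ : β < α, Rk G β C
termination_by α

theorem rk_iff {V : Type u} {G : SimpleGraph V} {α : Ordinal.{u}} {A : Set V} :
    Rk G α A ↔ ∃ S : Set V, S.Finite ∧ ∀ C : Set V, C ⊆ A \ S → Conn G C →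
    ∃ β : Ordinal.{u}, β < α ∧ Rk G β C := by
  rw [Rk]
  simp only [exists_prop]

theorem rk_le {V : Type u} {G : SimpleGraph V} {α α' : Ordinal.{u}} {A : Set V}
    (h : Rk G α A) (hle : α ≤ α') : Rk G α' A := by
  rw [rk_iff] at h ⊢
  obtain ⟨S, hS, h⟩ := h
  refine ⟨S, hS, fun C hC hc => ?_⟩
  obtain ⟨β, hβ, h⟩ := h C hC hc
  exact ⟨β, hβ.trans_le hle, h⟩

theorem rk_pull {V W : Type u} {G : SimpleGraph V} {H : SimpleGraph W} (f : V → W)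
    (hi : Function.Injective f) (hf : ∀ x y, G.Adj x y → H.Adj (f x) (f y))
    (α : Ordinal.{u}) : ∀ (A : Set V) (B : Set W), f '' A ⊆ B → Rk H α B → Rk G α A := by
  induction α using WellFoundedLT.induction with
  | ind α ih =>
    intro A B hAB h
    rw [rk_iff] at h ⊢
    obtain ⟨S, hS, h⟩ := h
    refine ⟨f ⁻¹' S, hS.preimage hi.injOn, fun C hC hc => ?_⟩
    obtain ⟨β, hβ, h⟩ := h (f '' C) (by
      rintro _ ⟨x, hx, rfl⟩
      exact ⟨hAB (mem_image_of_mem f (hC hx).1), (hC hx).2⟩) (hc.image f hf)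
    exact ⟨β, hβ, ih β hβ C _ le_rfl h⟩

theorem rk_mono {V : Type u} {G : SimpleGraph V} {α : Ordinal.{u}} {A B : Set V}
    (h : Rk G α B) (hAB : A ⊆ B) : Rk G α A :=
  rk_pull id Function.injective_id (fun _ _ h => h) α A B (by simpa using hAB) h

theorem rk_exists_of {V : Type u} {G : SimpleGraph V} {A S : Set V} (hS : S.Finite)
    (h : ∀ C : Set V, C ⊆ A \ S → Conn G C → ∃ β : Ordinal.{u}, Rk G β C) :
    ∃ α : Ordinal.{u}, Rk G α A := by
  classical
  have : ∀ C : Set V, ∃ β : Ordinal.{u}, C ⊆ A \ S → Conn G C → Rk G β C := by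
    intro C
    by_cases h1 : C ⊆ A \ S ∧ Conn G C
    · obtain ⟨β, hβ⟩ := h C h1.1 h1.2
      exact ⟨β, fun _ _ => hβ⟩
    · exact ⟨0, fun a b => absurd ⟨a, b⟩ h1⟩
  choose b hb using this
  refine ⟨⨆ C, Order.succ (b C), rk_iff.2 ⟨S, hS, fun C hC hc => ⟨b C, ?_, hb C hC hc⟩⟩⟩
  exact (Order.lt_succ (b C)).trans_le (Ordinal.le_iSup (fun C => Order.succ (b C)) C)

theorem rk_of_rayless {V : Type u} (G : SimpleGraph V) (hG : G.IsRayless) :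
    ∃ α : Ordinal.{u}, Rk G α univ := by
  by_contra hno
  have h0 : ∃ C : Set V, Conn G C ∧ ∀ β : Ordinal.{u}, ¬ Rk G β C := by
    by_contra h
    push Not at h
    exact hno (rk_exists_of (S := ∅) finite_empty (fun C _ hc => h C hc))
  let St := {p : V × Set V // p.1 ∈ p.2 ∧ Conn G p.2 ∧ ∀ β : Ordinal.{u}, ¬ Rk G β p.2}
  have step : ∀ p : St, ∃ q : St, G.Adj p.1.1 q.1.1 ∧ q.1.2 ⊆ p.1.2 \ {p.1.1} := by
    rintro ⟨⟨v, A⟩, hv, hA, hr⟩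
    simp only at hv hA hr
    have : ∃ C : Set V, C ⊆ A \ {v} ∧ Conn G C ∧ ∀ β : Ordinal.{u}, ¬ Rk G β C := by
      by_contra h
      push Not at h
      obtain ⟨α, hα⟩ := rk_exists_of (G := G) (A := A) (S := {v}) (finite_singleton v) h
      exact hr α hα
    obtain ⟨C, hCA, hC, hCr⟩ := this
    obtain ⟨x, hx⟩ := hC.1
    have hsub : C ⊆ comp G (A \ {v}) x := hC.sub_comp hCA hx
    have : ∃ z ∈ comp G (A \ {v}) x, G.Adj v z := by
      by_contra h
      push Not at h
      have := hA.2 (comp G (A \ {v}) x) ⟨x, (hCA hx).1, mem_comp_self x⟩ (by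
        intro a ha hac b hb hab
        refine comp_step hac ⟨hb, ?_⟩ hab
        rintro rfl
        exact h a hac hab.symm)
      exact (comp_sub (hCA hx) (this hv)).2 rfl
    obtain ⟨z, hz, hvz⟩ := this
    exact ⟨⟨⟨z, comp G (A \ {v}) x⟩, hz, comp_conn x, fun β hβ => hCr β (rk_mono hβ hsub)⟩,
      hvz, comp_sub (hCA hx)⟩
  choose nx hnx using step
  obtain ⟨C, hC, hCr⟩ := h0
  obtain ⟨x, hx⟩ := hC.1
  let s : ℕ → St := fun n => nx^[n] ⟨⟨x, C⟩, hx, hC, hCr⟩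
  have hs : ∀ n, s (n+1) = nx (s n) := fun n => Function.iterate_succ_apply' _ _ _
  have hanti : Antitone (fun n => (s n).1.2) := by
    refine antitone_nat_of_succ_le (fun n => ?_)
    show (s (n+1)).1.2 ⊆ _
    rw [hs]
    exact (hnx (s n)).2.trans sdiff_subset
  have hne : ∀ i j, i < j → (s i).1.1 ≠ (s j).1.1 := by
    intro i j hij h
    have h1 : (s j).1.1 ∈ (s (i+1)).1.2 := hanti (show i+1 ≤ j from hij) (s j).2.1
    rw [hs] at h1
    exact ((hnx (s i)).2 h1).2 h.symm
  refine hG ⟨fun n => (s n).1.1, ?_, fun n => ?_⟩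
  · intro i j hij
    rcases lt_trichotomy i j with h | h | h
    · exact absurd hij (hne i j h)
    · exact h
    · exact absurd hij.symm (hne j i h)
  · show G.Adj (s n).1.1 (s (n+1)).1.1
    rw [hs]
    exact (hnx (s n)).1

/-- the kernel at level `α` -/
def ker {V : Type u} (G : SimpleGraph V) (α : Ordinal.{u}) : Set V :=
  {v | ∀ F : Set V, F.Finite → v ∉ F →
    ∃ C, Conn G C ∧ v ∈ C ∧ Disjoint C F ∧ ∀ β < α, ¬ Rk G β C}

theorem ker_map {V W : Type u} {G : SimpleGraph V} {H : SimpleGraph W} (f : V → W)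
    (hi : Function.Injective f) (hf : ∀ x y, G.Adj x y → H.Adj (f x) (f y))
    (α : Ordinal.{u}) {v : V} (hv : v ∈ ker G α) : f v ∈ ker H α := by
  intro F hF hvF
  obtain ⟨C, hC, hvC, hd, hr⟩ := hv (f ⁻¹' F) (hF.preimage hi.injOn) hvF
  refine ⟨f '' C, hC.image f hf, mem_image_of_mem f hvC, ?_, fun β hβ h =>
    hr β hβ (rk_pull f hi hf β C _ le_rfl h)⟩
  rw [Set.disjoint_left] at hd ⊢
  rintro _ ⟨x, hx, rfl⟩
  exact hd hx

theorem ker_finite {V : Type u} {G : SimpleGraph V} {α : Ordinal.{u}} (h : Rk G α univ) :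
    (ker G α).Finite := by
  rw [rk_iff] at h
  obtain ⟨S, hS, h⟩ := h
  refine hS.subset (fun v hv => ?_)
  by_contra hvS
  obtain ⟨C, hC, hvC, hd, hr⟩ := hv S hS hvS
  obtain ⟨β, hβ, h⟩ := h C (fun x hx => ⟨trivial, Set.disjoint_left.1 hd hx⟩) hC
  exact hr β hβ h

theorem ker_remove {V : Type u} {G : SimpleGraph V} {α : Ordinal.{u}} {v : V} {B : Set V}
    (hv : v ∉ ker G α)
    (h : ∀ C, Conn G C → Disjoint C (insert v B) → ∃ β < α, Rk G β C) :
    ∀ C, Conn G C → Disjoint C B → ∃ β < α, Rk G β C := by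
  classical
  intro C hC hd
  rw [Set.disjoint_left] at hd
  by_cases hvC : v ∉ C
  · refine h C hC ?_
    rw [Set.disjoint_left]
    rintro a ha (rfl | hb)
    · exact hvC ha
    · exact hd ha hb
  push Not at hvC
  simp only [ker, mem_ofPred_eq, not_forall, not_exists] at hv
  obtain ⟨F, hF, hvF, hv⟩ := hv
  have hv' : ∀ D, Conn G D → v ∈ D → Disjoint D F → ∃ β < α, Rk G β D := by
    intro D h1 h2 h3
    have := hv D
    by_contra h4
    push Not at h4
    exact this ⟨h1, h2, h3, h4⟩
  let A := C \ {v}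
  have hadj : ∀ x ∈ A, ∃ z ∈ comp G A x, G.Adj v z := by
    intro x hx
    by_contra h
    push Not at h
    have := hC.2 (comp G A x) ⟨x, hx.1, mem_comp_self x⟩ (by
      intro a ha hac b hb hab
      refine comp_step hac ⟨hb, ?_⟩ hab
      rintro rfl
      exact h a hac hab.symm)
    exact (comp_sub hx (this hvC)).2 rfl
  let D0 : Set V := {w | w = v ∨ (w ∈ A ∧ Disjoint (comp G A w) F)}
  have hD0c : ∀ x ∈ A, Disjoint (comp G A x) F → comp G A x ⊆ D0 := by
    intro x hx hxd y hy
    exact Or.inr ⟨comp_sub hx hy, hxd.mono_left (comp_trans hy)⟩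
  have hD0 : Conn G D0 := by
    refine conn_of_root v (Or.inl rfl) ?_
    rintro T hvT hcl w (rfl | ⟨hwA, hwd⟩)
    · exact hvT
    · obtain ⟨z, hz, hvz⟩ := hadj w hwA
      have hsub := hD0c w hwA hwd
      have hzT := hcl v (Or.inl rfl) hvT z (hsub hz) hvz
      exact (comp_conn w).2 T ⟨z, hz, hzT⟩
        (fun a ha haT b hb hab => hcl a (hsub ha) haT b (hsub hb) hab) (mem_comp_self w)
  obtain ⟨β0, hβ0, hr0⟩ := hv' D0 hD0 (Or.inl rfl) (by
    rw [Set.disjoint_left]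
    rintro a (rfl | ⟨_, had⟩)
    · exact hvF
    · exact Set.disjoint_left.1 had (mem_comp_self a))
  have hb : ∀ f, ∃ β < α, f ∈ A → Rk G β (comp G A f) := by
    intro f
    by_cases hf : f ∈ A
    · obtain ⟨β, hβ, hr⟩ := h (comp G A f) (comp_conn f) (by
        rw [Set.disjoint_left]
        rintro a ha (rfl | hb)
        · exact (comp_sub hf ha).2 rfl
        · exact hd (comp_sub hf ha).1 hb)
      exact ⟨β, hβ, fun _ => hr⟩
    · exact ⟨β0, hβ0, fun h => absurd h hf⟩
  choose b hbα hb using hb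
  let βs := max β0 (hF.toFinset.sup b)
  have hβs : βs < α := by
    refine max_lt hβ0 ?_
    rw [Finset.sup_lt_iff]
    · exact fun f _ => hbα f
    · exact lt_of_le_of_lt bot_le hβ0
  refine ⟨βs, hβs, ?_⟩
  have hS : ∀ f, ∃ S : Set V, S.Finite ∧ (f ∈ A → ∀ C : Set V, C ⊆ comp G A f \ S → Conn G C →
    ∃ β : Ordinal.{u}, β < b f ∧ Rk G β C) := by
    intro f
    by_cases hf : f ∈ A
    · obtain ⟨S, hS, h⟩ := rk_iff.1 (hb f hf)
      exact ⟨S, hS, fun _ => h⟩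
    · exact ⟨∅, finite_empty, fun h => absurd h hf⟩
  choose S hSf hS using hS
  obtain ⟨S0, hS0f, hS0⟩ := rk_iff.1 hr0
  refine rk_iff.2 ⟨{v} ∪ S0 ∪ ⋃ f ∈ F, S f,
    ((finite_singleton v).union hS0f).union (hF.biUnion (fun f _ => hSf f)), ?_⟩
  intro C' hC' hc'
  have hC'A : C' ⊆ A := fun y hy => ⟨(hC' hy).1, fun h => (hC' hy).2 (Or.inl (Or.inl h))⟩
  obtain ⟨x, hx⟩ := hc'.1
  have hsub := hc'.sub_comp hC'A hx
  by_cases hxd : Disjoint (comp G A x) F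
  · obtain ⟨β, hβ, hr⟩ := hS0 C' (fun y hy => ⟨hD0c x (hC'A hx) hxd (hsub hy),
      fun h => (hC' hy).2 (Or.inl (Or.inr h))⟩) hc'
    exact ⟨β, hβ.trans_le (le_max_left _ _), hr⟩
  · rw [Set.not_disjoint_iff] at hxd
    obtain ⟨f, hfx, hfF⟩ := hxd
    have hfA := comp_sub (hC'A hx) hfx
    obtain ⟨β, hβ, hr⟩ := hS f hfA C' (fun y hy =>
      ⟨comp_trans (comp_symm (hC'A hx) hfx) (hsub hy),
      fun h => (hC' hy).2 (Or.inr (mem_biUnion hfF h))⟩) hc'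
    refine ⟨β, hβ.trans_le (le_trans ?_ (le_max_right _ _)), hr⟩
    exact Finset.le_sup (f := b) (hF.mem_toFinset.2 hfF)

theorem ker_spec {V : Type u} {G : SimpleGraph V} {α : Ordinal.{u}} (h : Rk G α univ) :
    ∀ C, Conn G C → Disjoint C (ker G α) → ∃ β < α, Rk G β C := by
  classical
  have key : ∀ T : Finset V, (∀ t ∈ T, t ∉ ker G α) → ∀ B : Set V,
      (∀ C, Conn G C → Disjoint C (↑T ∪ B) → ∃ β < α, Rk G β C) →
      ∀ C, Conn G C → Disjoint C B → ∃ β < α, Rk G β C := by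
    intro T
    induction T using Finset.induction_on with
    | empty => intro _ B h; simpa using h
    | insert t T _ ih =>
      intro hT B h
      refine ih (fun s hs => hT s (Finset.mem_insert_of_mem hs)) B ?_
      refine ker_remove (hT t (Finset.mem_insert_self t T)) ?_
      simpa [Set.insert_union] using h
  obtain ⟨S, hS, h⟩ := rk_iff.1 h
  refine key (hS.toFinset.filter (· ∉ ker G α)) (fun t ht => (Finset.mem_filter.1 ht).2) _ ?_
  intro C hC hd
  refine h C (fun x hx => ⟨trivial, fun hxS => ?_⟩) hC
  refine Set.disjoint_left.1 hd hx ?_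
  by_cases hxk : x ∈ ker G α
  · exact Or.inr hxk
  · exact Or.inl (by simp [hxS, hxk])

/-- coloured graphs -/
structure CG (Γ : Type) : Type (u+1) where
  V : Type u
  G : SimpleGraph V
  c : V → Γ

variable {Γ : Type}

structure IsEmb (A B : CG.{u} Γ) (f : A.V → B.V) : Prop where
  inj : Function.Injective f
  adj : ∀ x y, B.G.Adj (f x) (f y) ↔ A.G.Adj x y
  col : ∀ x, B.c (f x) = A.c x

theorem IsEmb.hom {A B : CG.{u} Γ} {f : A.V → B.V} (h : IsEmb A B f) :
    ∀ x y, A.G.Adj x y → B.G.Adj (f x) (f y) := fun x y => (h.adj x y).2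

theorem isEmb_id (A : CG.{u} Γ) : IsEmb A A id :=
  ⟨Function.injective_id, fun _ _ => Iff.rfl, fun _ => rfl⟩

theorem IsEmb.comp {A B C : CG.{u} Γ} {g : B.V → C.V} {f : A.V → B.V}
    (hg : IsEmb B C g) (hf : IsEmb A B f) : IsEmb A C (fun x => g (f x)) :=
  ⟨hg.inj.comp hf.inj, fun x y => (hg.adj _ _).trans (hf.adj x y),
    fun x => (hg.col _).trans (hf.col x)⟩

theorem IsEmb.of_comp {A B C : CG.{u} Γ} {g : B.V → C.V} {f : A.V → B.V}
    (hg : IsEmb B C g) (hgf : IsEmb A C (fun x => g (f x))) : IsEmb A B f :=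
  ⟨fun _ _ h => hgf.inj (congrArg g h), fun x y => (hg.adj _ _).symm.trans (hgf.adj x y),
    fun x => (hg.col _).symm.trans (hgf.col x)⟩

def LE (A B : CG.{u} Γ) : Prop := ∃ f, IsEmb A B f

def Iso (A B : CG.{u} Γ) : Prop := ∃ f, IsEmb A B f ∧ Function.Surjective f

def Eqv (A B : CG.{u} Γ) : Prop := LE A B ∧ LE B A

theorem LE.refl (A : CG.{u} Γ) : LE A A := ⟨_, isEmb_id A⟩

theorem LE.trans {A B C : CG.{u} Γ} (h : LE A B) (h' : LE B C) : LE A C := by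
  obtain ⟨f, hf⟩ := h
  obtain ⟨g, hg⟩ := h'
  exact ⟨_, hg.comp hf⟩

theorem IsEmb.inv {A B : CG.{u} Γ} {f : A.V → B.V} (hf : IsEmb A B f)
    (hs : Function.Surjective f) :
    ∃ g, IsEmb B A g ∧ Function.Surjective g ∧ (∀ x, g (f x) = x) ∧ ∀ y, f (g y) = y := by
  choose g hg using hs
  refine ⟨g, hf.of_comp ?_, fun x => ⟨f x, hf.inj (hg _)⟩, fun x => hf.inj (hg _), hg⟩
  simp only [hg]
  exact isEmb_id B

theorem Iso.refl (A : CG.{u} Γ) : Iso A A := ⟨_, isEmb_id A, Function.surjective_id⟩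

theorem Iso.symm {A B : CG.{u} Γ} (h : Iso A B) : Iso B A := by
  obtain ⟨f, hf, hs⟩ := h
  obtain ⟨g, hg, hgs, _⟩ := hf.inv hs
  exact ⟨g, hg, hgs⟩

theorem Iso.trans {A B C : CG.{u} Γ} (h : Iso A B) (h' : Iso B C) : Iso A C := by
  obtain ⟨f, hf, hs⟩ := h
  obtain ⟨g, hg, hs'⟩ := h'
  exact ⟨_, hg.comp hf, hs'.comp hs⟩

theorem Iso.le {A B : CG.{u} Γ} (h : Iso A B) : LE A B := by
  obtain ⟨f, hf, hs⟩ := h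
  exact ⟨f, hf⟩

theorem Iso.eqv {A B : CG.{u} Γ} (h : Iso A B) : Eqv A B := ⟨h.le, h.symm.le⟩

theorem Eqv.symm {A B : CG.{u} Γ} (h : Eqv A B) : Eqv B A := ⟨h.2, h.1⟩

theorem Eqv.trans {A B C : CG.{u} Γ} (h : Eqv A B) (h' : Eqv B C) : Eqv A C :=
  ⟨h.1.trans h'.1, h'.2.trans h.2⟩

def Cn (A : CG.{u} Γ) : Prop := Conn A.G univ

theorem Iso.cn {A B : CG.{u} Γ} (h : Iso A B) (hA : Cn A) : Cn B := by
  obtain ⟨f, hf, hs⟩ := h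
  have := hA.image f hf.hom
  rwa [image_univ, hs.range_eq] at this

def rk (α : Ordinal.{u}) (A : CG.{u} Γ) : Prop := Rk A.G α univ

theorem rk_of_le {A B : CG.{u} Γ} {α : Ordinal.{u}} (h : LE A B) (hB : rk α B) : rk α A := by
  obtain ⟨f, hf⟩ := h
  exact rk_pull f hf.inj hf.hom α _ _ (subset_univ _) hB

/-- A connected ranked graph has no two disjoint self-embeddings. -/
theorem excl {A : CG.{u} Γ} (hc : Cn A) {α : Ordinal.{u}} (hr : rk α A) {f g : A.V → A.V}
    (hf : IsEmb A A f) (hg : IsEmb A A g) (hd : ∀ x y, f x ≠ g y) : False := by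
  induction α using WellFoundedLT.induction with
  | ind α ih =>
    have hfin := ker_finite hr
    have hne : (ker A.G α).Nonempty := by
      by_contra h
      rw [Set.not_nonempty_iff_eq_empty] at h
      obtain ⟨β, hβ, h⟩ := ker_spec hr univ hc (by rw [h]; simp)
      exact ih β hβ h
    have himg : ∀ k : A.V → A.V, IsEmb A A k → k '' ker A.G α = ker A.G α := by
      intro k hk
      refine Set.eq_of_subset_of_ncard_le ?_ ?_ hfin
      · rintro _ ⟨x, hx, rfl⟩
        exact ker_map k hk.inj hk.hom α hx
      · rw [Set.ncard_image_of_injective _ hk.inj]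
    obtain ⟨x, hx⟩ := hne
    obtain ⟨a, _, ha⟩ : x ∈ f '' ker A.G α := by rw [himg f hf]; exact hx
    obtain ⟨b, _, hb⟩ : x ∈ g '' ker A.G α := by rw [himg g hg]; exact hx
    exact hd a b (ha.trans hb.symm)

/-! ### disjoint unions -/

inductive SigAdj {I : Type u} (C : I → CG.{u} Γ) :
    (Σ i, (C i).V) → (Σ i, (C i).V) → Prop
  | mk (i : I) (x y : (C i).V) (h : (C i).G.Adj x y) : SigAdj C ⟨i, x⟩ ⟨i, y⟩

def Sig {I : Type u} (C : I → CG.{u} Γ) : CG.{u} Γ where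
  V := Σ i, (C i).V
  G := { Adj := SigAdj C
         symm := ⟨by rintro _ _ ⟨i, x, y, h⟩; exact ⟨i, y, x, h.symm⟩⟩
         loopless := ⟨by
          intro a h
          generalize hb : a = b at h
          have : SigAdj C a b := by rw [← hb] at h ⊢; exact h
          clear h
          cases this with
          | mk i x y h =>
            cases hb
            exact (C i).G.loopless.irrefl _ h⟩ }
  c := fun a => (C a.1).c a.2

section Sig
variable {I J : Type u} {C : I → CG.{u} Γ} {D : J → CG.{u} Γ}

def Sig.mk (C : I → CG.{u} Γ) (i : I) (x : (C i).V) : (Sig C).V := ⟨i, x⟩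

theorem sig_adj_same (i : I) (x y : (C i).V) :
    (Sig C).G.Adj (Sig.mk C i x) (Sig.mk C i y) ↔ (C i).G.Adj x y := by
  constructor
  · intro h
    cases h
    assumption
  · exact fun h => ⟨i, x, y, h⟩

theorem sig_adj_fst {a b : (Sig C).V} (h : (Sig C).G.Adj a b) : a.1 = b.1 := by
  cases h
  rfl

theorem isEmb_mk (C : I → CG.{u} Γ) (i : I) : IsEmb (C i) (Sig C) (Sig.mk C i) :=
  ⟨fun x y h => by cases h; rfl, fun x y => sig_adj_same i x y, fun _ => rfl⟩

def Apart (B : CG.{u} Γ) (x y : B.V) : Prop := x ≠ y ∧ ¬ B.G.Adj x y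

theorem Apart.symm {B : CG.{u} Γ} {x y : B.V} (h : Apart B x y) : Apart B y x :=
  ⟨h.1.symm, fun h' => h.2 h'.symm⟩

theorem apart_of_fst {a b : (Sig C).V} (h : a.1 ≠ b.1) : Apart (Sig C) a b :=
  ⟨fun h' => h (by rw [h']), fun h' => h (sig_adj_fst h')⟩

theorem IsEmb.apart {A B : CG.{u} Γ} {f : A.V → B.V} (hf : IsEmb A B f) {x y : A.V} :
    Apart B (f x) (f y) ↔ Apart A x y := by
  unfold Apart
  rw [hf.adj, hf.inj.ne_iff]

theorem sig_desc {B : CG.{u} Γ} (f : ∀ i, (C i).V → B.V) (hf : ∀ i, IsEmb (C i) B (f i))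
    (hd : ∀ i j, i ≠ j → ∀ x y, Apart B (f i x) (f j y)) :
    IsEmb (Sig C) B (fun a => f a.1 a.2) := by
  refine ⟨?_, ?_, fun a => (hf a.1).col a.2⟩
  · rintro ⟨i, x⟩ ⟨j, y⟩ h
    by_cases hij : i = j
    · subst hij
      exact congrArg (Sig.mk C i) ((hf i).inj h)
    · exact absurd h (hd i j hij x y).1
  · rintro ⟨i, x⟩ ⟨j, y⟩
    by_cases hij : i = j
    · subst hij
      exact ((hf i).adj x y).trans (sig_adj_same i x y).symm
    · exact ⟨fun h => absurd h (hd i j hij x y).2, fun h => absurd (sig_adj_fst h) hij⟩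

/-- reindexing along an injection -/
theorem sig_reindex (e : I → J) (he : Function.Injective e)
    (f : ∀ i, (C i).V → (D (e i)).V) (hf : ∀ i, IsEmb (C i) (D (e i)) (f i)) :
    IsEmb (Sig C) (Sig D) (fun a => Sig.mk D (e a.1) (f a.1 a.2)) := by
  refine sig_desc (fun i x => Sig.mk D (e i) (f i x)) (fun i => (isEmb_mk D (e i)).comp (hf i)) ?_
  intro i j hij x y
  exact apart_of_fst (fun h => hij (he h))

theorem sig_le (e : I → J) (he : Function.Injective e) (h : ∀ i, LE (C i) (D (e i))) :
    LE (Sig C) (Sig D) := by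
  choose f hf using h
  exact ⟨_, sig_reindex e he f hf⟩

theorem sig_iso (e : I ≃ J) (h : ∀ i, Iso (C i) (D (e i))) : Iso (Sig C) (Sig D) := by
  choose f hf hs using h
  refine ⟨_, sig_reindex e e.injective f hf, ?_⟩
  rintro ⟨j, y⟩
  obtain ⟨i, rfl⟩ := e.surjective j
  obtain ⟨x, rfl⟩ := hs i y
  exact ⟨⟨i, x⟩, rfl⟩

/-- an embedding with image in the components of a subfamily lifts -/
theorem sig_restrict {A : CG.{u} Γ} (e : I → J) (he : Function.Injective e) (f : A.V → (Sig D).V)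
    (hf : IsEmb A (Sig D) f) (h : ∀ a, ∃ i, (f a).1 = e i) :
    LE A (Sig (fun i => D (e i))) := by
  have h' : ∀ a, ∃ b : (Sig (fun i => D (e i))).V, Sig.mk D (e b.1) b.2 = f a := by
    intro a
    obtain ⟨i, hi⟩ := h a
    generalize f a = z at hi
    obtain ⟨j, y⟩ := z
    simp only at hi
    subst hi
    exact ⟨⟨i, y⟩, rfl⟩
  choose g hg using h'
  refine ⟨g, (sig_reindex (C := fun i => D (e i)) (D := D) e he (fun _ x => x)
    (fun i => isEmb_id (D (e i)))).of_comp ?_⟩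
  simp only [hg]
  exact hf

theorem emb_of_fst {A : CG.{u} Γ} {f : A.V → (Sig D).V} (hf : IsEmb A (Sig D) f) {j : J}
    (h : ∀ a, (f a).1 = j) : ∃ g, IsEmb A (D j) g ∧ ∀ a, f a = Sig.mk D j (g a) := by
  have h' : ∀ a, ∃ b : (D j).V, f a = Sig.mk D j b := by
    intro a
    have hi := h a
    generalize f a = z at hi
    obtain ⟨j, y⟩ := z
    simp only at hi
    subst hi
    exact ⟨y, rfl⟩
  choose g hg using h'
  refine ⟨g, (isEmb_mk D j).of_comp ?_, hg⟩
  simp only [← hg]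
  exact hf

theorem exists_fst {A : CG.{u} Γ} (hA : Cn A) {f : A.V → (Sig D).V} (hf : IsEmb A (Sig D) f) :
    ∃ j, ∀ a, (f a).1 = j := by
  obtain ⟨a0, _⟩ := hA.1
  refine ⟨(f a0).1, fun a => ?_⟩
  refine hA.2 {a | (f a).1 = (f a0).1} ⟨a0, trivial, rfl⟩ ?_ (mem_univ a)
  intro x _ hx y _ hxy
  exact (sig_adj_fst (hf.hom _ _ hxy)).symm.trans hx

theorem index_map (hC : ∀ i, Cn (C i)) {f : (Sig C).V → (Sig D).V} (hf : IsEmb (Sig C) (Sig D) f) :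
    ∃ e : I → J, (∀ i x, (f (Sig.mk C i x)).1 = e i) := by
  have : ∀ i, ∃ j, ∀ x, (f (Sig.mk C i x)).1 = j :=
    fun i => exists_fst (hC i) (hf.comp (isEmb_mk C i))
  choose e he using this
  exact ⟨e, he⟩

theorem sig_iso_index (hC : ∀ i, Cn (C i)) (hD : ∀ j, Cn (D j)) (h : Iso (Sig C) (Sig D)) :
    ∃ e : I ≃ J, ∀ i, Iso (C i) (D (e i)) := by
  obtain ⟨f, hf, hs⟩ := h
  obtain ⟨g, hg, hgs, hgf, hfg⟩ := hf.inv hs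
  obtain ⟨e, he⟩ := index_map hC hf
  obtain ⟨e', he'⟩ := index_map hD hg
  have h1 : ∀ i (x : (C i).V), e' (e i) = i := by
    intro i x
    have h2 := hgf (Sig.mk C i x)
    have h3 : f (Sig.mk C i x) = Sig.mk D (f (Sig.mk C i x)).1 (f (Sig.mk C i x)).2 := rfl
    rw [h3] at h2
    have h4 := he' (f (Sig.mk C i x)).1 (f (Sig.mk C i x)).2
    rw [h2, he i x] at h4
    exact h4.symm
  have h2 : ∀ j (y : (D j).V), e (e' j) = j := by
    intro i x
    have h2 := hfg (Sig.mk D i x)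
    have h3 : g (Sig.mk D i x) = Sig.mk C (g (Sig.mk D i x)).1 (g (Sig.mk D i x)).2 := rfl
    rw [h3] at h2
    have h4 := he (g (Sig.mk D i x)).1 (g (Sig.mk D i x)).2
    rw [h2, he' i x] at h4
    exact h4.symm
  have k1 : ∀ i, e' (e i) = i := fun i => (hC i).1.elim (fun x _ => h1 i x)
  have k2 : ∀ j, e (e' j) = j := fun j => (hD j).1.elim (fun x _ => h2 j x)
  refine ⟨⟨e, e', k1, k2⟩, fun i => ?_⟩
  obtain ⟨k, hk, hk'⟩ := emb_of_fst (hf.comp (isEmb_mk C i)) (he i)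
  refine ⟨k, hk, fun y => ?_⟩
  have h3 : (g (Sig.mk D (e i) y)).1 = i := (he' _ _).trans (k1 i)
  have h5 := hfg (Sig.mk D (e i) y)
  generalize g (Sig.mk D (e i) y) = z at h3 h5
  obtain ⟨i', x⟩ := z
  simp only at h3
  subst h3
  refine ⟨x, ?_⟩
  have h6 := (hk' x).symm.trans h5
  exact (isEmb_mk D (e i')).inj h6

end Sig

def CG.sub (M : CG.{u} Γ) (S : Set M.V) : CG.{u} Γ where
  V := S
  G := M.G.induce S
  c := fun x => M.c x.1

theorem isEmb_sub (M : CG.{u} Γ) (S : Set M.V) :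
    IsEmb (M.sub S) M (fun x : S => x.1) :=
  ⟨Subtype.val_injective, fun _ _ => Iff.rfl, fun _ => rfl⟩

theorem cn_sub {M : CG.{u} Γ} {S : Set M.V} (h : Conn M.G S) : Cn (M.sub S) := by
  obtain ⟨⟨v, hv⟩, h⟩ := h
  refine ⟨⟨⟨v, hv⟩, trivial⟩, ?_⟩
  rintro T ⟨x, _, hx⟩ hcl y _
  have := h (Subtype.val '' (T : Set S)) ⟨x.1, x.2, ⟨x, hx, rfl⟩⟩ (by
    rintro _ _ ⟨a, ha, rfl⟩ b hb hab
    exact ⟨⟨b, hb⟩, hcl a trivial ha ⟨b, hb⟩ trivial hab, rfl⟩) y.2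
  obtain ⟨z, hz, hzy⟩ := this
  rwa [← Subtype.val_injective hzy]

/-- decomposition into components -/
theorem decomp (M : CG.{u} Γ) : ∃ (I : Type u) (C : I → CG.{u} Γ), (∀ i, Cn (C i)) ∧
    (∀ i, ∃ S : Set M.V, Conn M.G S ∧ C i = M.sub S) ∧ Iso (Sig C) M := by
  refine ⟨{S : Set M.V // ∃ v, S = comp M.G univ v}, fun S => M.sub S.1, ?_, ?_, ?_⟩
  · rintro ⟨_, v, rfl⟩
    exact cn_sub (comp_conn v)
  · rintro ⟨_, v, rfl⟩
    exact ⟨_, comp_conn v, rfl⟩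
  · refine ⟨_, sig_desc (fun i (x : i.1) => x.1) (fun i => isEmb_sub M i.1) ?_, ?_⟩
    · rintro ⟨_, v, rfl⟩ ⟨_, w, rfl⟩ hvw ⟨x, hx⟩ ⟨y, hy⟩
      have key : x ∉ comp M.G univ w := by
        intro hxw
        apply hvw
        apply Subtype.ext
        refine Subset.antisymm ?_ ?_
        · exact (comp_trans (comp_symm (mem_univ _) hx)).trans (comp_trans hxw)
        · exact (comp_trans (comp_symm (mem_univ _) hxw)).trans (comp_trans hx)
      refine ⟨?_, fun h => ?_⟩
      · rintro rfl
        exact key hy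
      · exact key (comp_step hy trivial (SimpleGraph.Adj.symm h))
    · intro x
      exact ⟨Sig.mk _ ⟨comp M.G univ x, x, rfl⟩ ⟨x, mem_comp_self x⟩, rfl⟩

def Att (p : Γ → Prop) (M : CG.{u} Γ) : Prop :=
  ∀ T : Set M.V, T.Nonempty → (∀ x ∈ T, ∀ y, M.G.Adj x y → y ∈ T) → ∃ y ∈ T, p (M.c y)

theorem Att.iso {p : Γ → Prop} {M N : CG.{u} Γ} (h : Iso M N) (hM : Att p M) : Att p N := by
  obtain ⟨f, hf, hs⟩ := h
  intro T ⟨t, ht⟩ hcl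
  obtain ⟨x, rfl⟩ := hs t
  obtain ⟨y, hy, hpy⟩ := hM (f ⁻¹' T) ⟨x, ht⟩ (fun a ha b hab => hcl _ ha _ (hf.hom _ _ hab))
  exact ⟨f y, hy, by rw [hf.col]; exact hpy⟩

theorem att_sig {I : Type u} {C : I → CG.{u} Γ} (hC : ∀ i, Cn (C i)) (p : Γ → Prop) :
    Att p (Sig C) ↔ ∀ i, ∃ x, p ((C i).c x) := by
  constructor
  · intro h i
    obtain ⟨x, _⟩ := (hC i).1
    obtain ⟨⟨j, y⟩, hy, hpy⟩ := h {a | a.1 = i} ⟨Sig.mk C i x, rfl⟩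
      (fun a ha b hab => (sig_adj_fst hab).symm.trans ha)
    have hy' : j = i := hy
    subst hy'
    exact ⟨y, hpy⟩
  · rintro h T ⟨⟨i, x⟩, hx⟩ hcl
    obtain ⟨y, hy⟩ := h i
    refine ⟨Sig.mk C i y, ?_, hy⟩
    refine (hC i).2 {z | Sig.mk C i z ∈ T} ⟨x, trivial, hx⟩ ?_ (mem_univ y)
    intro a _ ha b _ hab
    exact hcl _ ha _ ((sig_adj_same i a b).2 hab)

def IH (A : CG.{u} Γ) : Prop := ∀ B, Cn B → Eqv A B → ¬ Iso A B →
  ∃ F : ℕ → CG.{u} Γ, (∀ i, Cn (F i) ∧ Eqv A (F i)) ∧ ∀ i j, i ≠ j → ¬ Iso (F i) (F j)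

def Tw (A : CG.{u} Γ) : Prop := ∃ B, Cn B ∧ Eqv A B ∧ ¬ Iso A B

def Many (M N : CG.{u} Γ) : Prop := ∃ F : ℕ → CG.{u} Γ,
  (∀ i, Eqv M (F i)) ∧ (∀ i j, i ≠ j → ¬ Iso (F i) (F j)) ∧
  ∀ p, Att p M → Att p N → ∀ i, Att p (F i)

theorem Many.symm {M N : CG.{u} Γ} (h : Many M N) (hMN : Eqv M N) : Many N M := by
  obtain ⟨F, h1, h2, h3⟩ := h
  exact ⟨F, fun i => hMN.symm.trans (h1 i), h2, fun p a b => h3 p b a⟩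

section many
variable {I J : Type u} {C : I → CG.{u} Γ} {D : J → CG.{u} Γ}

theorem many_of_tw (hC : ∀ i, Cn (C i)) (i0 : I) (hI : IH (C i0)) (ht : Tw (C i0))
    (N : CG.{u} Γ) : Many (Sig C) N := by
  classical
  obtain ⟨B, hB, hAB, hn⟩ := ht
  obtain ⟨F, hF, hFn⟩ := hI B hB hAB hn
  let E : ℕ → I → CG.{u} Γ := fun n i => if Eqv (C i0) (C i) then F n else C i
  have hE1 : ∀ n i, Eqv (C i0) (C i) → E n i = F n := fun n i h => if_pos h
  have hE2 : ∀ n i, ¬ Eqv (C i0) (C i) → E n i = C i := fun n i h => if_neg h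
  have hEe : ∀ n i, Eqv (C i) (E n i) := by
    intro n i
    by_cases h : Eqv (C i0) (C i)
    · rw [hE1 n i h]
      exact h.symm.trans (hF n).2
    · rw [hE2 n i h]
      exact (Iso.refl _).eqv
  have hEc : ∀ n i, Cn (E n i) := by
    intro n i
    by_cases h : Eqv (C i0) (C i)
    · rw [hE1 n i h]
      exact (hF n).1
    · rw [hE2 n i h]
      exact hC i
  refine ⟨fun n => Sig (E n), fun n => ⟨?_, ?_⟩, ?_, ?_⟩
  · exact sig_le id Function.injective_id (fun i => (hEe n i).1)
  · exact sig_le id Function.injective_id (fun i => (hEe n i).2)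
  · intro n m hnm hiso
    obtain ⟨e, he⟩ := sig_iso_index (hEc n) (hEc m) hiso
    have h1 := he i0
    rw [hE1 n i0 (Iso.refl _).eqv] at h1
    by_cases h : Eqv (C i0) (C (e i0))
    · rw [hE1 m _ h] at h1
      exact hFn n m hnm h1
    · rw [hE2 m _ h] at h1
      exact h ((hF n).2.trans h1.eqv)
  · intro p hM _ n
    rw [att_sig hC] at hM
    refine (att_sig (hEc n) p).2 (fun i => ?_)
    obtain ⟨x, hx⟩ := hM i
    obtain ⟨f, hf⟩ := (hEe n i).1
    exact ⟨f x, by rw [hf.col]; exact hx⟩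

/-- the non-`κ` components of `C` plus `Q` copies of `κ` -/
def Mcf (C : I → CG.{u} Γ) (κ : CG.{u} Γ) (Q : Type u) :
    ({i : I // ¬ Iso (C i) κ} ⊕ Q) → CG.{u} Γ :=
  Sum.elim (fun i => C i.1) (fun _ => κ)

theorem mc_mono {κ : CG.{u} Γ} {Q Q' : Type u} (e : Q → Q') (he : Function.Injective e) :
    LE (Sig (Mcf C κ Q)) (Sig (Mcf C κ Q')) := by
  refine sig_le (Sum.map id e) (Function.injective_id.sumMap he) ?_
  rintro (i | q)
  · exact LE.refl _
  · exact LE.refl _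

theorem mc_eqv (κ : CG.{u} Γ) : Eqv (Sig C) (Sig (Mcf C κ {i : I // Iso (C i) κ})) := by
  classical
  refine (sig_iso ((Equiv.sumComm _ _).trans (Equiv.sumCompl (fun i => Iso (C i) κ))) ?_).symm.eqv
  rintro (i | q)
  · exact Iso.refl _
  · exact q.2.symm

/-- the key absorption lemma -/
theorem absorb (hC : ∀ i, Cn (C i)) (hD : ∀ j, Cn (D j)) {κ : CG.{u} Γ} (hκ : Cn κ)
    (hκt : ¬ Tw κ) {φ : (Sig C).V → (Sig D).V} {ψ : (Sig D).V → (Sig C).V}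
    (hφ : IsEmb (Sig C) (Sig D) φ) (hψ : IsEmb (Sig D) (Sig C) ψ) (e : J → I)
    (he : ∀ j y, (ψ (Sig.mk D j y)).1 = e j) (Q : Type u) :
    LE (Sig (Mcf C κ (Q ⊕ {j : J // Iso (D j) κ ∧ ¬ Iso (C (e j)) κ})))
      (Sig (Mcf C κ Q)) := by
  classical
  obtain ⟨e', he'⟩ := index_map hC hφ
  have hleD : ∀ i, LE (C i) (D (e' i)) := fun i => by
    obtain ⟨k, hk, _⟩ := emb_of_fst (hφ.comp (isEmb_mk C i)) (he' i)
    exact ⟨k, hk⟩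
  have hleC : ∀ j, LE (D j) (C (e j)) := fun i => by
    obtain ⟨k, hk, _⟩ := emb_of_fst (hψ.comp (isEmb_mk D i)) (he i)
    exact ⟨k, hk⟩
  let P := {j : J // Iso (D j) κ ∧ ¬ Iso (C (e j)) κ}
  let O : Set I := {i | LE κ (C i) ∧ ¬ Iso (C i) κ}
  have hup : ∀ i ∈ O, ¬ LE (C i) κ := by
    rintro i ⟨h1, h2⟩ h3
    apply hκt
    exact ⟨C i, hC i, ⟨h1, h3⟩, fun h => h2 h.symm⟩
  have hPO : ∀ j : P, e j.1 ∈ O := fun j => ⟨j.2.1.symm.le.trans (hleC j.1), j.2.2⟩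
  have hOO : ∀ i ∈ O, e (e' i) ∈ O := by
    intro i hi
    refine ⟨hi.1.trans ((hleD i).trans (hleC _)), fun h => ?_⟩
    exact hup i hi (((hleD i).trans (hleC _)).trans h.le)
  have hOP : ∀ i ∈ O, ¬ Iso (D (e' i)) κ := fun i hi h => hup i hi ((hleD i).trans h.le)
  have hPiso : ∀ j : P, ∃ f, IsEmb κ (D j.1) f := fun j => j.2.1.symm.le
  choose q hq using hPiso
  -- big target
  let B : (I ⊕ Q) → CG.{u} Γ := Sum.elim C (fun _ => κ)
  let ι : (Sig C).V → (Sig B).V := fun a => Sig.mk B (Sum.inl a.1) a.2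
  have hι : IsEmb (Sig C) (Sig B) ι :=
    sig_reindex (C := C) (D := B) Sum.inl Sum.inl_injective (fun _ x => x) (fun i => isEmb_id (C i))
  have hι1 : ∀ a, (ι a).1 = Sum.inl a.1 := fun _ => rfl
  have hψ1 : ∀ a, (ψ a).1 = e a.1 := fun a => he a.1 a.2
  have hφ1 : ∀ a, (φ a).1 = e' a.1 := fun a => he' a.1 a.2
  let f : ∀ s : {i : I // ¬ Iso (C i) κ} ⊕ (Q ⊕ P), (Mcf C κ (Q ⊕ P) s).V → (Sig B).V :=
    fun s => match s with
    | Sum.inl i => fun x : (C i.1).V =>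
        if i.1 ∈ O then ι (ψ (φ (Sig.mk C i.1 x))) else ι (Sig.mk C i.1 x)
    | Sum.inr (Sum.inl t) => fun x : κ.V => Sig.mk B (Sum.inr t) x
    | Sum.inr (Sum.inr j) => fun x : κ.V => ι (ψ (Sig.mk D j.1 (q j x)))
  have hf : ∀ s, IsEmb (Mcf C κ (Q ⊕ P) s) (Sig B) (f s) := by
    rintro (i | t | j)
    · by_cases hi : i.1 ∈ O
      · have : f (Sum.inl i) = fun x => ι (ψ (φ (Sig.mk C i.1 x))) := by
          funext x
          exact if_pos hi
        rw [this]
        exact hι.comp (hψ.comp (hφ.comp (isEmb_mk C i.1)))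
      · have : f (Sum.inl i) = fun x => ι (Sig.mk C i.1 x) := by
          funext x
          exact if_neg hi
        rw [this]
        exact hι.comp (isEmb_mk C i.1)
    · exact isEmb_mk B (Sum.inr t)
    · exact hι.comp (hψ.comp ((isEmb_mk D j.1).comp (hq j)))
  have hfp : ∀ (i : {i : I // ¬ Iso (C i) κ}) (x : (C i.1).V), i.1 ∈ O →
      f (Sum.inl i) x = ι (ψ (φ (Sig.mk C i.1 x))) := fun i x h => if_pos h
  have hfn : ∀ (i : {i : I // ¬ Iso (C i) κ}) (x : (C i.1).V), i.1 ∉ O →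
      f (Sum.inl i) x = ι (Sig.mk C i.1 x) := fun i x h => if_neg h
  have hft : ∀ (t : Q) (x : κ.V), f (Sum.inr (Sum.inl t)) x = Sig.mk B (Sum.inr t) x :=
    fun _ _ => rfl
  have hfj : ∀ (j : P) (x : κ.V), f (Sum.inr (Sum.inr j)) x = ι (ψ (Sig.mk D j.1 (q j x))) :=
    fun _ _ => rfl
  have hfi : ∀ (i : {i : I // ¬ Iso (C i) κ}) (x : (C i.1).V), ∃ k : I, ¬ Iso (C k) κ ∧
      (f (Sum.inl i) x).1 = Sum.inl k := by
    intro i x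
    by_cases hi : i.1 ∈ O
    · refine ⟨e (e' i.1), (hOO _ hi).2, ?_⟩
      rw [hfp i x hi, hι1, hψ1, hφ1]
      rfl
    · refine ⟨i.1, i.2, ?_⟩
      rw [hfn i x hi]
      rfl
  -- apartness in one direction
  have hij : ∀ (i : {i : I // ¬ Iso (C i) κ}) (j : P) x y,
      Apart (Sig B) (f (Sum.inl i) x) (f (Sum.inr (Sum.inr j)) y) := by
    intro i j x y
    rw [hfj j y]
    by_cases hi : i.1 ∈ O
    · rw [hfp i x hi, hι.apart, hψ.apart]
      apply apart_of_fst
      rw [hφ1]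
      intro h
      refine hOP _ hi ?_
      have h' : e' i.1 = j.1 := h
      rw [h']
      exact j.2.1
    · rw [hfn i x hi, hι.apart]
      apply apart_of_fst
      rw [hψ1]
      intro h
      have h' : i.1 = e j.1 := h
      exact hi (h' ▸ hPO j)
  have hii : ∀ (i i' : {i : I // ¬ Iso (C i) κ}) x y, i.1 ∈ O → i'.1 ∉ O →
      Apart (Sig B) (f (Sum.inl i) x) (f (Sum.inl i') y) := by
    intro i i' x y hi hi'
    rw [hfp i x hi, hfn i' y hi', hι.apart]
    apply apart_of_fst
    rw [hψ1, hφ1]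
    intro h
    have h' : e (e' i.1) = i'.1 := h
    exact hi' (h' ▸ hOO _ hi)
  have hit : ∀ (i : {i : I // ¬ Iso (C i) κ}) (t : Q) x y,
      Apart (Sig B) (f (Sum.inl i) x) (f (Sum.inr (Sum.inl t)) y) := by
    intro i t x y
    obtain ⟨k, _, hk⟩ := hfi i x
    apply apart_of_fst
    rw [hk]
    exact Sum.inl_ne_inr
  have htj : ∀ (t : Q) (j : P) x y,
      Apart (Sig B) (f (Sum.inr (Sum.inl t)) x) (f (Sum.inr (Sum.inr j)) y) := by
    intro t j x y
    apply apart_of_fst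
    exact Sum.inr_ne_inl
  have hemb := sig_desc (C := Mcf C κ (Q ⊕ P)) (B := Sig B) f hf (by
    rintro (i | t | j) (i' | t' | j') hne x y
    · have hne' : i.1 ≠ i'.1 := fun h => hne (by rw [Subtype.ext h])
      by_cases hi : i.1 ∈ O <;> by_cases hi' : i'.1 ∈ O
      · rw [hfp i x hi, hfp i' y hi', hι.apart, hψ.apart, hφ.apart]
        exact apart_of_fst hne'
      · exact hii i i' x y hi hi'
      · exact (hii i' i y x hi' hi).symm
      · rw [hfn i x hi, hfn i' y hi', hι.apart]
        exact apart_of_fst hne'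
    · exact hit i t' x y
    · exact hij i j' x y
    · exact (hit i' t y x).symm
    · apply apart_of_fst
      intro h
      exact hne (congrArg Sum.inr (congrArg Sum.inl (Sum.inr_injective h)))
    · exact htj t j' x y
    · exact (hij i' j y x).symm
    · exact (htj t' j y x).symm
    · rw [hfj j x, hfj j' y, hι.apart, hψ.apart]
      apply apart_of_fst
      intro h
      exact hne (congrArg Sum.inr (congrArg Sum.inr (Subtype.ext h))))
  have hres := sig_restrict (D := B) (I := {i : I // ¬ Iso (C i) κ} ⊕ Q)
    (Sum.map (fun i => i.1) id) (Subtype.val_injective.sumMap Function.injective_id) _ hemb (by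
    rintro ⟨(i | t | j), x⟩
    · obtain ⟨k, hk, h⟩ := hfi i x
      exact ⟨Sum.inl ⟨k, hk⟩, h⟩
    · exact ⟨Sum.inr t, rfl⟩
    · refine ⟨Sum.inl ⟨e j.1, (hPO j).2⟩, ?_⟩
      show (ι (ψ (Sig.mk D j.1 (q j x)))).1 = _
      rw [hι1, hψ1]
      rfl)
  refine hres.trans (sig_le id Function.injective_id ?_)
  rintro (i | t)
  · exact LE.refl _
  · exact LE.refl _

theorem many_of_card (hC : ∀ i, Cn (C i)) (hD : ∀ j, Cn (D j))
    {α : Ordinal.{u}} (j0 : J) (hκr : rk α (D j0)) (hκt : ¬ Tw (D j0))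
    (heqv : Eqv (Sig C) (Sig D))
    (hlt : Cardinal.mk {i : I // Iso (C i) (D j0)} < Cardinal.mk {j : J // Iso (D j) (D j0)}) :
    Many (Sig C) (Sig D) := by
  classical
  obtain ⟨⟨φ, hφ⟩, ⟨ψ, hψ⟩⟩ := heqv
  obtain ⟨e, he⟩ := index_map hD hψ
  let κ := D j0
  have hκ : Cn κ := hD j0
  let P := {j : J // Iso (D j) κ ∧ ¬ Iso (C (e j)) κ}
  have habs : ∀ Q : Type u, LE (Sig (Mcf C κ (Q ⊕ P))) (Sig (Mcf C κ Q)) :=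
    fun Q => absorb hC hD hκ hκt hφ hψ e he Q
  -- exclusivity
  have hinj : ∀ j j', Iso (D j) κ → Iso (D j') κ → Iso (C (e j)) κ → e j = e j' → j = j' := by
    intro j j' hj hj' hi hee
    by_contra hne
    obtain ⟨k, hk, hk'⟩ := emb_of_fst (hψ.comp (isEmb_mk D j)) (he j)
    obtain ⟨l, hl, hl'⟩ := emb_of_fst (hψ.comp (isEmb_mk D j')) (j := e j)
      (fun y => (he j' y).trans hee.symm)
    obtain ⟨a, ha⟩ := hj.symm.le
    obtain ⟨a', ha'⟩ := hj'.symm.le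
    obtain ⟨b, hb⟩ := hi.le
    refine excl hκ hκr (hb.comp (hk.comp ha)) (hb.comp (hl.comp ha')) ?_
    intro x y h
    have h1 := hb.inj h
    have h2 : ψ (Sig.mk D j (a x)) = ψ (Sig.mk D j' (a' y)) := by
      rw [hk', hl', h1]
    exact hne (congrArg Sigma.fst (hψ.inj h2))
  have hcard : Cardinal.mk {j : J // Iso (D j) κ} ≤
      Cardinal.mk P + Cardinal.mk {i : I // Iso (C i) κ} := by
    rw [Cardinal.add_def]
    let F : {j : J // Iso (D j) κ} → P ⊕ {i : I // Iso (C i) κ} := fun j =>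
      if h : Iso (C (e j.1)) κ then Sum.inr ⟨e j.1, h⟩ else Sum.inl ⟨j.1, j.2, h⟩
    refine Cardinal.mk_le_of_injective (f := F) ?_
    rintro ⟨j, hj⟩ ⟨j', hj'⟩ h
    simp only [F] at h
    split_ifs at h with h1 h2 h2
    · have := congrArg Subtype.val (Sum.inr_injective h)
      exact Subtype.ext (hinj j j' hj hj' h1 this)
    · have h3 := Sum.inl_injective h
      exact Subtype.ext (congrArg (fun z : P => z.1) h3)
  have hP : Nonempty P := by
    by_contra h
    rw [not_nonempty_iff] at h
    rw [Cardinal.mk_eq_zero P, zero_add] at hcard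
    exact absurd hcard (not_le.2 hlt)
  obtain ⟨p0⟩ := hP
  have hfin : ∀ n : ℕ, LE (Sig (Mcf C κ (ULift.{u} (Fin n)))) (Sig (Mcf C κ PEmpty.{u+1})) := by
    intro n
    induction n with
    | zero => exact mc_mono (fun x => x.down.elim0) (fun x => x.down.elim0)
    | succ n ih =>
      refine LE.trans ?_ ((habs _).trans ih)
      let g : ULift.{u} (Fin (n+1)) → ULift.{u} (Fin n) ⊕ P := fun x =>
        if h : x.down.1 < n then Sum.inl ⟨⟨x.down.1, h⟩⟩ else Sum.inr p0
      refine mc_mono g ?_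
      rintro ⟨x⟩ ⟨y⟩ h
      simp only [g] at h
      split_ifs at h with h1 h2 h2
      · have := Sum.inl_injective h
        simp only [ULift.up.injEq, Fin.mk.injEq] at this
        exact congrArg ULift.up (Fin.ext this)
      · exact congrArg ULift.up (Fin.ext (by omega))
  have hM0 : LE (Sig C) (Sig (Mcf C κ PEmpty.{u+1})) := by
    refine (mc_eqv κ).1.trans ?_
    rcases finite_or_infinite {i : I // Iso (C i) κ} with hf | hi
    · obtain ⟨n, ⟨g⟩⟩ := Finite.exists_equiv_fin {i : I // Iso (C i) κ}
      exact (mc_mono (fun x => ULift.up (g x))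
        (fun x y h => g.injective (ULift.up_injective h))).trans (hfin n)
    · have hle : Cardinal.mk {i : I // Iso (C i) κ} ≤ Cardinal.mk P := by
        by_contra h
        push Not at h
        have h3 : Cardinal.mk P + Cardinal.mk {i : I // Iso (C i) κ} =
          Cardinal.mk {i : I // Iso (C i) κ} :=
          Cardinal.add_eq_right (Cardinal.aleph0_le_mk _) h.le
        rw [h3] at hcard
        exact absurd hcard (not_le.2 hlt)
      obtain ⟨g⟩ := Cardinal.le_def _ _ |>.1 hle
      exact (mc_mono (fun x => Sum.inr (g x))
        (fun x y h => g.injective (Sum.inr_injective h))).trans (habs PEmpty.{u+1})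
  have hcn : ∀ (Q : Type u) s, Cn (Mcf C κ Q s) := by
    rintro Q (i | q)
    · exact hC i.1
    · exact hκ
  refine ⟨fun n => Sig (Mcf C κ (ULift.{u} (Fin n))), fun n => ⟨?_, ?_⟩, ?_, ?_⟩
  · exact hM0.trans (mc_mono (fun x => x.elim) (fun x => x.elim))
  · refine (hfin n).trans ((mc_mono (fun x => x.elim) (fun x => x.elim)).trans (mc_eqv κ).2)
  · intro n m hnm hiso
    obtain ⟨s, hs⟩ := sig_iso_index (hcn _) (hcn _) hiso
    have key : ∀ {a b : ℕ} (s : ({i : I // ¬ Iso (C i) κ} ⊕ ULift.{u} (Fin a)) →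
        ({i : I // ¬ Iso (C i) κ} ⊕ ULift.{u} (Fin b))), Function.Injective s →
        (∀ i, Iso (Mcf C κ _ i) (Mcf C κ _ (s i))) → a ≤ b := by
      intro a b s hsi hs
      have : ∀ x : Fin a, ∃ y : Fin b, s (Sum.inr ⟨x⟩) = Sum.inr ⟨y⟩ := by
        intro x
        have h1 := hs (Sum.inr ⟨x⟩)
        rcases hsx : s (Sum.inr ⟨x⟩) with i | y
        · rw [hsx] at h1
          exact absurd h1.symm i.2
        · exact ⟨y.down, rfl⟩
      choose g hg using this
      have hgi : Function.Injective g := by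
        intro x y h
        have h1 : s (Sum.inr ⟨x⟩) = s (Sum.inr ⟨y⟩) := by rw [hg, hg, h]
        have h2 := Sum.inr_injective (hsi h1)
        exact ULift.up_injective h2
      simpa using Fintype.card_le_of_injective g hgi
    apply hnm
    refine le_antisymm (key s s.injective hs) (key s.symm s.symm.injective ?_)
    intro i
    have := hs (s.symm i)
    rw [s.apply_symm_apply] at this
    exact this.symm
  · intro p hp hp' n
    rw [att_sig hC] at hp
    rw [att_sig hD] at hp'
    refine (att_sig (hcn _) p).2 ?_
    rintro (i | q)
    · exact hp i.1
    · exact hp' j0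

theorem iso_of_card (h : ∀ κ : CG.{u} Γ,
    Cardinal.mk {i : I // Iso (C i) κ} = Cardinal.mk {j : J // Iso (D j) κ}) :
    Iso (Sig C) (Sig D) := by
  classical
  let st : Setoid (CG.{u} Γ) := ⟨Iso, Iso.refl, Iso.symm, Iso.trans⟩
  let a : I → Quotient st := fun i => Quotient.mk st (C i)
  let b : J → Quotient st := fun j => Quotient.mk st (D j)
  have hq : ∀ q : Quotient st, Nonempty ({i // a i = q} ≃ {j // b j = q}) := by
    intro q
    induction q using Quotient.inductionOn with
    | h κ =>
      obtain ⟨g⟩ := Cardinal.eq.1 (h κ)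
      refine ⟨(Equiv.subtypeEquivRight ?_).trans (g.trans (Equiv.subtypeEquivRight ?_))⟩
      · intro i
        exact Quotient.eq (r := st)
      · intro j
        exact (Quotient.eq (r := st)).symm
  let E : I ≃ J := (Equiv.sigmaFiberEquiv a).symm.trans
    ((Equiv.sigmaCongrRight (fun q => (hq q).some)).trans (Equiv.sigmaFiberEquiv b))
  refine sig_iso E (fun i => ?_)
  have : b (E i) = a i := ((hq (a i)).some ⟨i, rfl⟩).2
  exact Iso.symm (Quotient.exact this)

theorem many_main (hC : ∀ i, Cn (C i)) (hD : ∀ j, Cn (D j))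
    (hCr : ∀ i, ∃ α : Ordinal.{u}, rk α (C i)) (hDr : ∀ j, ∃ α : Ordinal.{u}, rk α (D j))
    (hCI : ∀ i, IH (C i)) (hDI : ∀ j, IH (D j))
    (heqv : Eqv (Sig C) (Sig D)) (hn : ¬ Iso (Sig C) (Sig D)) : Many (Sig C) (Sig D) := by
  by_cases h1 : ∃ i, Tw (C i)
  · obtain ⟨i, hi⟩ := h1
    exact many_of_tw hC i (hCI i) hi _
  by_cases h2 : ∃ j, Tw (D j)
  · obtain ⟨j, hj⟩ := h2
    exact (many_of_tw hD j (hDI j) hj _).symm heqv.symm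
  push Not at h1 h2
  have : ∃ κ : CG.{u} Γ,
      Cardinal.mk {i : I // Iso (C i) κ} ≠ Cardinal.mk {j : J // Iso (D j) κ} := by
    by_contra h
    push Not at h
    exact hn (iso_of_card h)
  obtain ⟨κ, hκ⟩ := this
  rcases lt_or_gt_of_ne hκ with h | h
  · have hne : Cardinal.mk {j : J // Iso (D j) κ} ≠ 0 := (pos_of_gt h).ne'
    rw [Cardinal.mk_ne_zero_iff] at hne
    obtain ⟨j0, hj0⟩ := hne
    obtain ⟨α, hα⟩ := hDr j0
    refine many_of_card hC hD j0 hα (h2 j0) heqv ?_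
    have e : ∀ A : CG.{u} Γ, Iso A (D j0) ↔ Iso A κ :=
      fun A => ⟨fun h => h.trans hj0, fun h => h.trans hj0.symm⟩
    simp only [e]
    exact h
  · have hne : Cardinal.mk {i : I // Iso (C i) κ} ≠ 0 := (pos_of_gt h).ne'
    rw [Cardinal.mk_ne_zero_iff] at hne
    obtain ⟨j0, hj0⟩ := hne
    obtain ⟨α, hα⟩ := hCr j0
    refine (many_of_card hD hC j0 hα (h1 j0) heqv.symm ?_).symm heqv.symm
    have e : ∀ A : CG.{u} Γ, Iso A (C j0) ↔ Iso A κ :=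
      fun A => ⟨fun h => h.trans hj0, fun h => h.trans hj0.symm⟩
    simp only [e]
    exact h

end many

/-! ### cones over a finite kernel -/

section cone
variable {n : ℕ}

def coneAdj (A : SimpleGraph (Fin n)) (M : CG.{u} (Γ × Set (Fin n))) :
    Fin n ⊕ M.V → Fin n ⊕ M.V → Prop
  | Sum.inl i, Sum.inl j => A.Adj i j
  | Sum.inl i, Sum.inr y => i ∈ (M.c y).2
  | Sum.inr x, Sum.inl j => j ∈ (M.c x).2
  | Sum.inr x, Sum.inr y => M.G.Adj x y

def Cone (A : SimpleGraph (Fin n)) (d : Fin n → Γ) (M : CG.{u} (Γ × Set (Fin n))) : CG.{u} Γ where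
  V := Fin n ⊕ M.V
  G := { Adj := coneAdj A M
         symm := ⟨by
          rintro (i | x) (j | y) h
          · exact SimpleGraph.Adj.symm (G := A) h
          · exact h
          · exact h
          · exact SimpleGraph.Adj.symm (G := M.G) h⟩
         loopless := ⟨by
          rintro (i | x) h
          · exact A.loopless.irrefl _ h
          · exact M.G.loopless.irrefl _ h⟩ }
  c := Sum.elim d (fun x => (M.c x).1)

variable {A : SimpleGraph (Fin n)} {d : Fin n → Γ} {M N : CG.{u} (Γ × Set (Fin n))}

def cl (A : SimpleGraph (Fin n)) (d : Fin n → Γ) (M : CG.{u} (Γ × Set (Fin n))) (i : Fin n) :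
    (Cone A d M).V := Sum.inl i

def cr (A : SimpleGraph (Fin n)) (d : Fin n → Γ) (M : CG.{u} (Γ × Set (Fin n))) (x : M.V) :
    (Cone A d M).V := Sum.inr x

theorem cone_cases (z : (Cone A d M).V) : (∃ i, z = cl A d M i) ∨ ∃ x, z = cr A d M x := by
  rcases z with i | x
  · exact Or.inl ⟨i, rfl⟩
  · exact Or.inr ⟨x, rfl⟩

theorem cl_inj {i j : Fin n} (h : cl A d M i = cl A d M j) : i = j := Sum.inl_injective h

theorem cr_inj {i j : M.V} (h : cr A d M i = cr A d M j) : i = j := Sum.inr_injective h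

theorem cl_ne_cr {i : Fin n} {x : M.V} (h : cl A d M i = cr A d M x) : False :=
  Sum.inl_ne_inr h

theorem cone_map {f : M.V → N.V} (hf : IsEmb M N f) :
    ∃ g, IsEmb (Cone A d M) (Cone A d N) g ∧ (∀ i, g (cl A d M i) = cl A d N i) ∧
      (∀ x, g (cr A d M x) = cr A d N (f x)) ∧
      (Function.Surjective f → Function.Surjective g) := by
  refine ⟨Sum.map id f, ⟨Function.injective_id.sumMap hf.inj, ?_, ?_⟩, fun _ => rfl, fun _ => rfl,
    fun hs => Function.surjective_id.sumMap hs⟩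
  · rintro (i | x) (j | y)
    · exact Iff.rfl
    · show i ∈ (N.c (f y)).2 ↔ i ∈ (M.c y).2
      rw [hf.col]
    · show j ∈ (N.c (f x)).2 ↔ j ∈ (M.c x).2
      rw [hf.col]
    · exact hf.adj x y
  · rintro (i | x)
    · rfl
    · show (N.c (f x)).1 = (M.c x).1
      rw [hf.col]

theorem cone_restrict {h : (Cone A d M).V → (Cone A d N).V} (hh : IsEmb (Cone A d M) (Cone A d N) h)
    (hl : ∀ i, h (cl A d M i) = cl A d N i) :
    ∃ f, IsEmb M N f ∧ (Function.Surjective h → Function.Surjective f) := by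
  have h1 : ∀ x, ∃ y, h (cr A d M x) = cr A d N y := by
    intro x
    rcases cone_cases (h (cr A d M x)) with ⟨i, hi⟩ | h
    · rw [← hl] at hi
      exact (cl_ne_cr (hh.inj hi).symm).elim
    · exact h
  choose f hf using h1
  refine ⟨f, ⟨?_, ?_, ?_⟩, ?_⟩
  · intro x y hxy
    apply cr_inj (A := A) (d := d)
    apply hh.inj
    rw [hf, hf, hxy]
  · intro x y
    have := hh.adj (cr A d M x) (cr A d M y)
    rw [hf, hf] at this
    exact this
  · intro x
    have h1 := hh.col (cr A d M x)
    rw [hf] at h1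
    refine Prod.ext h1 ?_
    ext i
    have := hh.adj (cl A d M i) (cr A d M x)
    rw [hf, hl] at this
    exact this
  · intro hs y
    obtain ⟨z, hz⟩ := hs (cr A d N y)
    rcases cone_cases z with ⟨i, rfl⟩ | ⟨x, rfl⟩
    · rw [hl] at hz
      exact (cl_ne_cr hz).elim
    · rw [hf] at hz
      exact ⟨x, cr_inj hz⟩

theorem cone_le (h : LE M N) : LE (Cone A d M) (Cone A d N) := by
  obtain ⟨f, hf⟩ := h
  obtain ⟨g, hg, _⟩ := cone_map (A := A) (d := d) hf
  exact ⟨g, hg⟩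

theorem cone_iso (h : Iso M N) : Iso (Cone A d M) (Cone A d N) := by
  obtain ⟨f, hf, hs⟩ := h
  obtain ⟨g, hg, _, _, h⟩ := cone_map (A := A) (d := d) hf
  exact ⟨g, hg, h hs⟩

theorem cone_att (h : Cn (Cone A d M)) (i0 : Fin n) : Att (fun γ => γ.2.Nonempty) M := by
  rintro T ⟨t, ht⟩ hcl
  by_contra hno
  push Not at hno
  have := h.2 {z | ∃ x ∈ T, z = cr A d M x} ⟨cr A d M t, trivial, t, ht, rfl⟩ (by
    rintro _ _ ⟨x, hx, rfl⟩ y _ hxy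
    rcases cone_cases y with ⟨i, rfl⟩ | ⟨y, rfl⟩
    · have h1 : i ∈ (M.c x).2 := hxy
      rw [hno x hx] at h1
      exact h1.elim
    · exact ⟨y, hcl x hx y hxy, rfl⟩) (mem_univ (cl A d M i0))
  obtain ⟨x, _, hx⟩ := this
  exact cl_ne_cr hx

theorem cone_cn (h : Cn (Cone A d M)) (i0 : Fin n) (hle : LE M N)
    (hN : Att (fun γ => γ.2.Nonempty) N) : Cn (Cone A d N) := by
  obtain ⟨f, hf⟩ := hle
  obtain ⟨g, hg, hgl, _⟩ := cone_map (A := A) (d := d) hf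
  refine conn_of_root (cl A d N i0) trivial ?_
  intro T h0 hcl
  have hall : ∀ i, cl A d N i ∈ T := by
    intro i
    have := h.2 (g ⁻¹' T) ⟨cl A d M i0, trivial, by rw [mem_preimage, hgl]; exact h0⟩
      (fun x _ hx y _ hxy => hcl _ trivial hx _ trivial (hg.hom _ _ hxy)) (mem_univ (cl A d M i))
    rw [mem_preimage, hgl] at this
    exact this
  intro z _
  rcases cone_cases z with ⟨i, rfl⟩ | ⟨x, rfl⟩
  · exact hall i
  · by_contra hx
    obtain ⟨y, hy, i, hi⟩ := hN {x | cr A d N x ∉ T} ⟨x, hx⟩ (by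
      intro a ha b hab hb
      exact ha (hcl (cr A d N b) trivial hb (cr A d N a) trivial (SimpleGraph.Adj.symm (G := N.G) hab)))
    exact hy (hcl (cl A d N i) trivial (hall i) (cr A d N y) trivial hi)

def Base (B : CG.{u} Γ) (e : Fin n → B.V) : CG.{u} (Γ × Set (Fin n)) where
  V := {v : B.V // v ∉ range e}
  G := B.G.induce {v : B.V | v ∉ range e}
  c := fun v => (B.c v.1, {i | B.G.Adj (e i) v.1})

theorem cone_base (B : CG.{u} Γ) (e : Fin n → B.V) (he : Function.Injective e)
    (hA : ∀ i j, A.Adj i j ↔ B.G.Adj (e i) (e j)) (hd : ∀ i, d i = B.c (e i)) :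
    ∃ a, IsEmb (Cone A d (Base B e)) B a ∧ Function.Surjective a ∧
      (∀ i, a (cl A d (Base B e) i) = e i) := by
  let a : (Cone A d (Base B e)).V → B.V := fun z => Sum.elim e (fun x : (Base B e).V => x.1) z
  refine ⟨a, ⟨?_, ?_, ?_⟩, ?_, fun _ => rfl⟩
  · rintro (i | x) (j | y) h
    · exact congrArg Sum.inl (he h)
    · exact (y.2 ⟨i, h⟩).elim
    · exact (x.2 ⟨j, Eq.symm h⟩).elim
    · exact congrArg Sum.inr (Subtype.ext h)
  · rintro (i | x) (j | y)
    · exact (hA i j).symm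
    · exact Iff.rfl
    · exact B.G.adj_comm _ _
    · exact Iff.rfl
  · rintro (i | x)
    · exact (hd i).symm
    · rfl
  · intro v
    by_cases hv : v ∈ range e
    · obtain ⟨i, rfl⟩ := hv
      exact ⟨Sum.inl i, rfl⟩
    · exact ⟨Sum.inr ⟨v, hv⟩, rfl⟩

end cone

theorem isEmb_iter {A : CG.{u} Γ} {g : A.V → A.V} (hg : IsEmb A A g) (k : ℕ) :
    IsEmb A A g^[k] := by
  induction k with
  | zero => exact isEmb_id A
  | succ k ih => exact ih.comp hg

/-- normalise the embeddings so that they are mutually inverse on the kernel -/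
theorem exists_cones {α : Ordinal.{u}} {A B : CG.{u} Γ} (hA : rk α A) (h : Eqv A B) :
    ∃ (n : ℕ) (K : SimpleGraph (Fin n)) (d : Fin n → Γ) (M N : CG.{u} (Γ × Set (Fin n)))
      (a : (Cone K d M).V → A.V) (b : (Cone K d N).V → B.V),
      (IsEmb (Cone K d M) A a ∧ Function.Surjective a ∧
        ∀ x, a x ∈ ker A.G α ↔ ∃ i, x = cl K d M i) ∧
      (IsEmb (Cone K d N) B b ∧ Function.Surjective b ∧
        ∀ x, b x ∈ ker B.G α ↔ ∃ i, x = cl K d N i) ∧ Eqv M N := by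
  classical
  obtain ⟨⟨φ, hφ⟩, ⟨ψ, hψ⟩⟩ := h
  have hB : rk α B := rk_of_le ⟨ψ, hψ⟩ hA
  have hKf := ker_finite hA
  have hKf' := ker_finite hB
  have hφK : ∀ x ∈ ker A.G α, φ x ∈ ker B.G α := fun x hx => ker_map φ hφ.inj hφ.hom α hx
  have hψK : ∀ x ∈ ker B.G α, ψ x ∈ ker A.G α := fun x hx => ker_map ψ hψ.inj hψ.hom α hx
  have hsurj : φ '' ker A.G α = ker B.G α := by
    refine Set.eq_of_subset_of_ncard_le ?_ ?_ hKf'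
    · rintro _ ⟨x, hx, rfl⟩
      exact hφK x hx
    · rw [Set.ncard_image_of_injective _ hφ.inj, ← Set.ncard_image_of_injective _ hψ.inj]
      refine Set.ncard_le_ncard ?_ hKf
      rintro _ ⟨x, hx, rfl⟩
      exact hψK x hx
  have hg : IsEmb A A (fun x => ψ (φ x)) := hψ.comp hφ
  obtain ⟨k, hk⟩ : ∃ k : ℕ, ∀ x ∈ ker A.G α, (fun x => ψ (φ x))^[k + 1] x = x := by
    have : Finite (ker A.G α) := hKf
    let s : ker A.G α → ker A.G α := fun x => ⟨ψ (φ x.1), hψK _ (hφK _ x.2)⟩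
    have hs : Function.Injective s := fun x y h => Subtype.ext (hg.inj (congrArg Subtype.val h))
    let σ : Equiv.Perm (ker A.G α) := Equiv.ofBijective s (Finite.injective_iff_bijective.1 hs)
    have h1 : ∀ (m : ℕ) x, ((σ ^ m) x).1 = (fun x => ψ (φ x))^[m] x.1 := by
      intro m
      induction m with
      | zero => intro x; rfl
      | succ m ih =>
        intro x
        rw [pow_succ, Equiv.Perm.mul_apply, ih]
        rfl
    have hpos := orderOf_pos σ
    refine ⟨orderOf σ - 1, fun x hx => ?_⟩
    rw [Nat.sub_add_cancel hpos, ← h1 _ ⟨x, hx⟩, pow_orderOf_eq_one]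
    rfl
  obtain ⟨χ, hχ, hχφ⟩ : ∃ χ, IsEmb B A χ ∧ ∀ x ∈ ker A.G α, χ (φ x) = x :=
    ⟨_, (isEmb_iter hg k).comp hψ, hk⟩
  have : Finite (ker A.G α) := hKf
  obtain ⟨n, ⟨E⟩⟩ := Finite.exists_equiv_fin (ker A.G α)
  let e : Fin n → A.V := fun i => (E.symm i).1
  have hei : Function.Injective e := fun i j h => E.symm.injective (Subtype.ext h)
  have heK : ∀ v, v ∈ ker A.G α ↔ ∃ i, v = e i := by
    intro v
    constructor
    · intro hv
      refine ⟨E ⟨v, hv⟩, ?_⟩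
      simp only [e, Equiv.symm_apply_apply]
    · rintro ⟨i, rfl⟩
      exact (E.symm i).2
  let e' : Fin n → B.V := fun i => φ (e i)
  have hei' : Function.Injective e' := hφ.inj.comp hei
  have heK' : ∀ v, v ∈ ker B.G α ↔ ∃ i, v = e' i := by
    intro v
    rw [← hsurj]
    constructor
    · rintro ⟨x, hx, rfl⟩
      obtain ⟨i, rfl⟩ := (heK x).1 hx
      exact ⟨i, rfl⟩
    · rintro ⟨i, rfl⟩
      exact ⟨e i, (heK _).2 ⟨i, rfl⟩, rfl⟩
  obtain ⟨a, ha, has, hal⟩ := cone_base (A := A.G.comap e) (d := fun i => A.c (e i)) A e hei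
    (fun _ _ => Iff.rfl) (fun _ => rfl)
  obtain ⟨b, hb, hbs, hbl⟩ := cone_base (A := A.G.comap e) (d := fun i => A.c (e i)) B e' hei'
    (fun i j => (hφ.adj (e i) (e j)).symm) (fun i => (hφ.col _).symm)
  obtain ⟨a', ha', _, haa', _⟩ := ha.inv has
  obtain ⟨b', hb', _, hbb', _⟩ := hb.inv hbs
  refine ⟨n, _, _, _, _, a, b, ⟨ha, has, ?_⟩, ⟨hb, hbs, ?_⟩, ?_, ?_⟩
  · intro x
    rw [heK]
    refine exists_congr (fun i => ?_)
    rw [← hal i, ha.inj.eq_iff]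
  · intro x
    rw [heK']
    refine exists_congr (fun i => ?_)
    rw [← hbl i, hb.inj.eq_iff]
  · obtain ⟨f, hf, _⟩ := cone_restrict (hb'.comp (hφ.comp ha)) (by
      intro i
      show b' (φ (a _)) = _
      rw [hal]
      show b' (e' i) = _
      rw [← hbl, hbb'])
    exact ⟨f, hf⟩
  · obtain ⟨f, hf, _⟩ := cone_restrict (ha'.comp (hχ.comp hb)) (by
      intro i
      show a' (χ (b _)) = _
      rw [hbl]
      show a' (χ (φ (e i))) = _
      rw [hχφ _ ((heK _).2 ⟨i, rfl⟩), ← hal, haa'])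
    exact ⟨f, hf⟩

/-- many pairwise non-isomorphic bases give many pairwise non-isomorphic cones -/
theorem cones_many {n : ℕ} {K : SimpleGraph (Fin n)} {d : Fin n → Γ} {α : Ordinal.{u}}
    (F : ℕ → CG.{u} (Γ × Set (Fin n))) (hF : ∀ i j, i ≠ j → ¬ Iso (F i) (F j))
    (hker : ∀ i x, x ∈ ker (Cone K d (F i)).G α ↔ ∃ l, x = cl K d (F i) l) :
    ∃ s : ℕ → ℕ, ∀ i j, i ≠ j → ¬ Iso (Cone K d (F (s i))) (Cone K d (F (s j))) := by
  classical
  let st : Setoid ℕ := ⟨fun i j => Iso (Cone K d (F i)) (Cone K d (F j)),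
    fun _ => Iso.refl _, Iso.symm, Iso.trans⟩
  have hfin : ∀ i, {j | Iso (Cone K d (F i)) (Cone K d (F j))}.Finite := by
    intro i
    have h1 : ∀ j : {j | Iso (Cone K d (F i)) (Cone K d (F j))}, ∃ (g : _) (σ : Fin n → Fin n),
        IsEmb (Cone K d (F i)) (Cone K d (F j.1)) g ∧ Function.Surjective g ∧
        ∀ l, g (cl K d (F i) l) = cl K d (F j.1) (σ l) := by
      rintro ⟨j, g, hg, hs⟩
      have : ∀ l, ∃ m, g (cl K d (F i) l) = cl K d (F j) m := fun l =>
        (hker j _).1 (ker_map g hg.inj hg.hom α ((hker i _).2 ⟨l, rfl⟩))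
      choose σ hσ using this
      exact ⟨g, σ, hg, hs, hσ⟩
    choose g σ hg hs hσ using h1
    have hinj : Function.Injective σ := by
      intro j j' hjj
      by_contra hne
      apply hF j.1 j'.1 (fun h => hne (Subtype.ext h))
      obtain ⟨g', hg', hs', hgg, _⟩ := (hg j).inv (hs j)
      have hσi : Function.Injective (σ j) := by
        intro l m hlm
        apply cl_inj (A := K) (d := d) (M := F i)
        apply (hg j).inj
        rw [hσ, hσ, hlm]
      obtain ⟨f, hf, hfs⟩ := cone_restrict ((hg j').comp hg') (by
        intro m
        obtain ⟨l, rfl⟩ := Finite.injective_iff_surjective.1 hσi m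
        show g j' (g' _) = _
        rw [← hσ j l, hgg, hσ j' l, hjj])
      exact ⟨f, hf, hfs ((hs j').comp hs')⟩
    have := Finite.of_injective σ hinj
    exact Set.toFinite _
  have hinf : Infinite (Quotient st) := by
    rw [← not_finite_iff_infinite]
    intro hq
    have := Set.Finite.of_finite_fibers (s := univ) (fun i : ℕ => Quotient.mk st i)
      (Set.toFinite _) (by
      rintro _ ⟨i, _, rfl⟩
      refine (hfin i).subset ?_
      rintro j ⟨_, hj⟩
      exact (Quotient.exact hj : Iso _ _).symm)
    exact Set.infinite_univ this
  let E := Infinite.natEmbedding (Quotient st)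
  refine ⟨fun i => (E i).out, fun i j hij h => hij (E.injective ?_)⟩
  rw [← Quotient.out_eq (E i), ← Quotient.out_eq (E j)]
  exact Quotient.sound h

theorem base_comp_rk {n : ℕ} {K : SimpleGraph (Fin n)} {d : Fin n → Γ} {α : Ordinal.{u}}
    {A : CG.{u} Γ} {M : CG.{u} (Γ × Set (Fin n))} (hA : rk α A) {a : (Cone K d M).V → A.V}
    (ha : IsEmb (Cone K d M) A a) (hk : ∀ x, a x ∈ ker A.G α ↔ ∃ i, x = cl K d M i)
    {S : Set M.V} (hS : Conn M.G S) : ∃ β < α, rk β (M.sub S) := by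
  have hhom : ∀ x y, M.G.Adj x y → A.G.Adj (a (cr K d M x)) (a (cr K d M y)) :=
    fun x y h => ha.hom _ _ h
  obtain ⟨β, hβ, h⟩ := ker_spec hA _ (hS.image (fun x => a (cr K d M x)) hhom) (by
    rw [Set.disjoint_left]
    rintro _ ⟨x, hx, rfl⟩ hmem
    obtain ⟨i, hi⟩ := (hk _).1 hmem
    exact cl_ne_cr hi.symm)
  refine ⟨β, hβ, ?_⟩
  refine rk_pull (G := (M.sub S).G) (fun x : S => a (cr K d M x.1)) ?_ ?_ β univ _ ?_ h
  · intro x y hxy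
    exact Subtype.ext (cr_inj (ha.inj hxy))
  · intro x y hxy
    exact hhom _ _ hxy
  · rintro _ ⟨x, _, rfl⟩
    exact ⟨x.1, x.2, rfl⟩

theorem main (α : Ordinal.{u}) : ∀ (Γ : Type) (A B : CG.{u} Γ), rk α A → Eqv A B → ¬ Iso A B →
    ∃ F : ℕ → CG.{u} Γ, (∀ i, Eqv A (F i)) ∧ (∀ i j, i ≠ j → ¬ Iso (F i) (F j)) ∧
      (Cn A → Cn B → ∀ i, Cn (F i)) := by
  induction α using WellFoundedLT.induction with
  | ind α ih =>
  intro Γ A B hA hAB hn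
  by_cases h0 : Cn A ∧ ker A.G α = ∅
  · obtain ⟨hcA, hk⟩ := h0
    obtain ⟨β, hβ, h⟩ := ker_spec hA univ hcA (by rw [hk]; simp)
    exact ih β hβ Γ A B h hAB hn
  have hB : rk α B := rk_of_le hAB.2 hA
  have hIH : ∀ {Γ : Type} {A : CG.{u} Γ}, Cn A → (∃ β < α, rk β A) → IH A := by
    rintro Γ A hA ⟨β, hβ, hr⟩ B hB hAB hn
    obtain ⟨F, h1, h2, h3⟩ := ih β hβ Γ A B hr hAB hn
    exact ⟨F, fun i => ⟨h3 hA hB i, h1 i⟩, h2⟩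
  obtain ⟨n, K, d, M, N, a, b, ⟨ha, has, hak⟩, ⟨hb, hbs, hbk⟩, hMN⟩ := exists_cones hA hAB
  have hisoA : Iso (Cone K d M) A := ⟨a, ha, has⟩
  have hisoB : Iso (Cone K d N) B := ⟨b, hb, hbs⟩
  have hnMN : ¬ Iso M N := fun h => hn (hisoA.symm.trans ((cone_iso h).trans hisoB))
  obtain ⟨I, C, hC, hCS, hCM⟩ := decomp M
  obtain ⟨J, D, hD, hDS, hDN⟩ := decomp N
  have hCr : ∀ i, ∃ β < α, rk β (C i) := by
    intro i
    obtain ⟨S, hS, hi⟩ := hCS i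
    rw [hi]
    exact base_comp_rk hA ha hak hS
  have hDr : ∀ i, ∃ β < α, rk β (D i) := by
    intro i
    obtain ⟨S, hS, hi⟩ := hDS i
    rw [hi]
    exact base_comp_rk hB hb hbk hS
  obtain ⟨F, hF1, hF2, hF3⟩ := many_main hC hD (fun i => (hCr i).imp fun _ h => h.2)
    (fun i => (hDr i).imp fun _ h => h.2) (fun i => hIH (hC i) (hCr i))
    (fun i => hIH (hD i) (hDr i)) (hCM.eqv.trans (hMN.trans hDN.symm.eqv))
    (fun h => hnMN (hCM.symm.trans (h.trans hDN)))
  have hMF : ∀ i, Eqv M (F i) := fun i => hCM.symm.eqv.trans (hF1 i)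
  have hker : ∀ i x, x ∈ ker (Cone K d (F i)).G α ↔ ∃ l, x = cl K d (F i) l := by
    intro i x
    constructor
    · intro hx
      obtain ⟨f, hf⟩ := (hMF i).2
      obtain ⟨g, hg, hgl, hgr, _⟩ := cone_map (A := K) (d := d) hf
      have h1 := ker_map _ (ha.comp hg).inj (ha.comp hg).hom α hx
      obtain ⟨l, hl⟩ := (hak _).1 h1
      refine ⟨l, hg.inj ?_⟩
      rw [hl, hgl]
    · rintro ⟨l, rfl⟩
      obtain ⟨f, hf⟩ := (hMF i).1
      obtain ⟨g, hg, hgl, hgr, _⟩ := cone_map (A := K) (d := d) hf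
      obtain ⟨a', ha', _, haa', _⟩ := ha.inv has
      have h1 := ker_map _ (hg.comp ha').inj (hg.comp ha').hom α ((hak _).2 ⟨l, rfl⟩)
      rw [haa', hgl] at h1
      exact h1
  obtain ⟨s, hs⟩ := cones_many F hF2 hker
  refine ⟨fun i => Cone K d (F (s i)), fun i => ?_, hs, ?_⟩
  · exact hisoA.symm.eqv.trans ⟨cone_le (hMF _).1, cone_le (hMF _).2⟩
  · intro hcA hcB i
    have hne : (ker A.G α).Nonempty := by
      by_contra h
      exact h0 ⟨hcA, Set.not_nonempty_iff_eq_empty.1 h⟩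
    obtain ⟨v, hv⟩ := hne
    obtain ⟨z, rfl⟩ := has v
    obtain ⟨l, _⟩ := (hak z).1 hv
    have hcM := hisoA.symm.cn hcA
    have hcN := hisoB.symm.cn hcB
    exact cone_cn hcM l (hMF _).1 (hF3 _ ((cone_att hcM l).iso hCM.symm)
      ((cone_att hcN l).iso hDN.symm) _)

def toCG {V : Type u} (G : SimpleGraph V) (X : Set V) : CG.{u} Prop := ⟨V, G, fun v => v ∈ X⟩

theorem image_eq_of {V W : Type u} {X : Set V} {Y : Set W} (hX : X.Finite) (hY : Y.Finite)
    {f : V → W} {g : W → V} (hf : Function.Injective f) (hg : Function.Injective g)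
    (h1 : f '' X ⊆ Y) (h2 : g '' Y ⊆ X) : f '' X = Y := by
  refine Set.eq_of_subset_of_ncard_le h1 ?_ hY
  rw [Set.ncard_image_of_injective _ hf, ← Set.ncard_image_of_injective _ hg]
  exact Set.ncard_le_ncard h2 hX

theorem toCG_emb {V W : Type u} {G : SimpleGraph V} {H : SimpleGraph W} {X : Set V} {Y : Set W}
    (f : G ↪g H) (h : f '' X = Y) : IsEmb (toCG G X) (toCG H Y) f := by
  refine ⟨f.injective, fun x y => f.map_rel_iff, fun x => ?_⟩
  apply propext
  show f x ∈ Y ↔ x ∈ X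
  rw [← h]
  exact f.injective.mem_set_image

theorem pairIso_of_iso {A B : CG.{u} Prop} (h : Iso A B) :
    PairIso A.G {v | A.c v} B.G {v | B.c v} := by
  obtain ⟨f, hf, hs⟩ := h
  refine ⟨⟨Equiv.ofBijective f ⟨hf.inj, hs⟩, hf.adj _ _⟩, ?_⟩
  ext y
  constructor
  · rintro ⟨x, hx, rfl⟩
    show B.c (f x)
    rw [hf.col]
    exact hx
  · intro hy
    obtain ⟨x, rfl⟩ := hs y
    refine ⟨x, ?_, rfl⟩
    have hy' : B.c (f x) := hy
    rw [hf.col] at hy'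
    exact hy'

theorem iso_of_pairIso {A B : CG.{u} Prop} (h : PairIso A.G {v | A.c v} B.G {v | B.c v}) :
    Iso A B := by
  obtain ⟨γ, h⟩ := h
  exact ⟨γ, toCG_emb γ.toEmbedding h, γ.surjective⟩

theorem emb_of_le {A B : CG.{u} Prop} (h : LE A B) :
    ∃ φ : A.G ↪g B.G, ⇑φ '' {v | A.c v} ⊆ {v | B.c v} := by
  obtain ⟨f, hf⟩ := h
  refine ⟨⟨⟨f, hf.inj⟩, hf.adj _ _⟩, ?_⟩
  rintro _ ⟨x, hx, rfl⟩
  show B.c (f x)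
  rw [hf.col]
  exact hx

end RT

/-- If the pairs `(G, X)` and `(H, Y)` (with `G`, `H` rayless and `X`, `Y` finite)
are strong twins, then `(G, X)` has infinitely many pairwise non-isomorphic strong
twins. -/
theorem strongTwinPairs_infinite {V W : Type u} (G : SimpleGraph V) (H : SimpleGraph W)
    (X : Set V) (Y : Set W) (hX : X.Finite) (hY : Y.Finite)
    (hG : G.IsRayless) (hH : H.IsRayless)
    (htwin : StrongTwinPairs G X H Y) :
    ∃ F : ℕ → Σ W' : Type u, SimpleGraph W' × Set W',
      (∀ i, (F i).2.2.Finite) ∧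
      (∀ i j, i ≠ j → ¬ PairIso (F i).2.1 (F i).2.2 (F j).2.1 (F j).2.2) ∧
      ∀ i, StrongTwinPairs G X (F i).2.1 (F i).2.2 := by
  obtain ⟨hn, ⟨φ, hφ⟩, ⟨ψ, hψ⟩⟩ := htwin
  have h1 := RT.toCG_emb φ (RT.image_eq_of hX hY φ.injective ψ.injective hφ hψ)
  have h2 := RT.toCG_emb ψ (RT.image_eq_of hY hX ψ.injective φ.injective hψ hφ)
  obtain ⟨α, hα⟩ := RT.rk_of_rayless G hG
  obtain ⟨F, hF1, hF2, -⟩ := RT.main α Prop (RT.toCG G X) (RT.toCG H Y) hα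
    ⟨⟨_, h1⟩, ⟨_, h2⟩⟩ (fun h => hn (RT.pairIso_of_iso h))
  obtain ⟨k, hk⟩ : ∃ k : ℕ, ∀ i, ¬ RT.Iso (RT.toCG G X) (F (i + k)) := by
    by_cases h : ∃ m, RT.Iso (RT.toCG G X) (F m)
    · obtain ⟨m, hm⟩ := h
      refine ⟨m + 1, fun i hi => hF2 m (i + (m + 1)) (by omega) (hm.symm.trans hi)⟩
    · exact ⟨0, fun i hi => h ⟨_, hi⟩⟩
  refine ⟨fun i => ⟨(F (i + k)).V, (F (i + k)).G, {v | (F (i + k)).c v}⟩, ?_, ?_, ?_⟩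
  · intro i
    obtain ⟨f, hf⟩ := (hF1 (i + k)).2
    refine (hX.preimage (f := f) hf.inj.injOn).subset ?_
    intro v hv
    have h3 : (F (i + k)).c v := hv
    rw [← hf.col] at h3
    exact h3
  · intro i j hij h
    exact hF2 (i + k) (j + k) (by omega) (RT.iso_of_pairIso h)
  · intro i
    exact ⟨fun h => hk i (RT.iso_of_pairIso (A := RT.toCG G X) h),
      RT.emb_of_le (hF1 (i + k)).1, RT.emb_of_le (hF1 (i + k)).2⟩
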